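/- Let N' > 2, τ > −2 and p > (N'+2+2τ)/(N'−2). If v ∈ C²((0,R)) is a positive solution of v'' + ((N'−1)/r) v' + r^τ v^p = 0 on (0,R) with limsup_{r→0+} v(r) = ∞, then v(r) = C_0 r^{−(2+τ)/(p−1)} for every r ∈ (0,R), where C_0 = [((2+τ)/(p−1))(N'−2−(2+τ)/(p−1))]^{1/(p−1)}. In particular, V_∞(r) = C_0 r^{−(2+τ)/(p−1)} is the unique positive radial singular solution of the equation −div(|x|^θ ∇v) = |x|^l v^p over any punctured ball when p > (N'+2+2τ)/(N'−2). -/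

import Mathlib

open Set Filter

noncomputable section

open Topology

theorem monotoneOn_of_hasDerivAt_nonneg {f f' : ℝ → ℝ} {D : Set ℝ} (hD : Convex ℝ D)
    (hf : ∀ t ∈ D, HasDerivAt f (f' t) t) (hf' : ∀ t ∈ D, 0 ≤ f' t) : MonotoneOn f D :=
  monotoneOn_of_hasDerivWithinAt_nonneg hD
    (fun t ht => (hf t ht).continuousAt.continuousWithinAt)
    (fun t ht => (hf t (interior_subset ht)).hasDerivWithinAt)
    (fun t ht => hf' t (interior_subset ht))

theorem antitoneOn_of_hasDerivAt_nonpos {f f' : ℝ → ℝ} {D : Set ℝ} (hD : Convex ℝ D)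
    (hf : ∀ t ∈ D, HasDerivAt f (f' t) t) (hf' : ∀ t ∈ D, f' t ≤ 0) : AntitoneOn f D :=
  antitoneOn_of_hasDerivWithinAt_nonpos hD
    (fun t ht => (hf t ht).continuousAt.continuousWithinAt)
    (fun t ht => (hf t (interior_subset ht)).hasDerivWithinAt)
    (fun t ht => hf' t (interior_subset ht))

theorem nonpos_of_forall_le_mul_exp {A B c T : ℝ} (hc : 0 < c)
    (h : ∀ t < T, A ≤ B * Real.exp (c * t)) : A ≤ 0 := by
  have h1 : Tendsto (fun t => B * Real.exp (c * t)) atBot (𝓝 (B * 0)) :=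
    (Real.tendsto_exp_atBot.comp (tendsto_id.const_mul_atBot hc)).const_mul B
  rw [mul_zero] at h1
  exact ge_of_tendsto h1 ((eventually_lt_atBot T).mono h)

/-- Barbalat's lemma at `-∞`. -/
theorem tendsto_deriv_atBot_zero {f g h : ℝ → ℝ} {T l L : ℝ}
    (hf : ∀ t < T, HasDerivAt f (g t) t) (hg : ∀ t < T, HasDerivAt g (h t) t)
    (hL : ∀ t < T, |h t| ≤ L) (hlim : Tendsto f atBot (𝓝 l)) :
    Tendsto g atBot (𝓝 0) := by
  have hL0 : 0 ≤ L := (abs_nonneg _).trans (hL (T - 1) (by linarith))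
  rw [Metric.tendsto_nhds]
  intro ε hε
  obtain ⟨δ, hδ, hδL⟩ : ∃ δ > 0, L * δ ≤ ε / 2 := by
    refine ⟨ε / (2 * (L + 1)), by positivity, ?_⟩
    rw [mul_div_assoc', div_le_div_iff₀ (by positivity) (by positivity)]
    nlinarith
  have hshift : Tendsto (fun t => f t - f (t - δ)) atBot (𝓝 0) := by
    have h1 : Tendsto (fun t : ℝ => t - δ) atBot atBot :=
      tendsto_atBot_add_const_right _ (-δ) tendsto_id
    simpa using hlim.sub (hlim.comp h1)
  have hev := (Metric.tendsto_nhds.1 hshift) (δ * (ε / 2)) (by positivity)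
  filter_upwards [hev, eventually_lt_atBot T] with t ht htT
  obtain ⟨ξ, hξ, hξe⟩ := exists_hasDerivAt_eq_slope f g (show t - δ < t by linarith)
    (fun x hx => (hf x (hx.2.trans_lt htT)).continuousAt.continuousWithinAt)
    (fun x hx => hf x (hx.2.trans htT))
  have hgξ : |g ξ| < ε / 2 := by
    rw [hξe, abs_div, sub_sub_cancel, abs_of_pos hδ, div_lt_iff₀ hδ]
    simpa [mul_comm] using ht
  have hlip : |g t - g ξ| ≤ L * |t - ξ| := by
    have := (convex_Iio T).norm_image_sub_le_of_norm_hasDerivWithin_le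
      (fun x hx => (hg x hx).hasDerivWithinAt) (fun x hx => hL x hx)
      (show ξ ∈ Iio T from hξ.2.trans htT) (show t ∈ Iio T from htT)
    simpa using this
  have hdist : |t - ξ| ≤ δ := by
    rw [abs_of_pos (by linarith [hξ.2])]
    linarith [hξ.1]
  have : L * |t - ξ| ≤ L * δ := mul_le_mul_of_nonneg_left hdist hL0
  rw [Real.dist_eq, sub_zero]
  have h3 := abs_add_le (g t - g ξ) (g ξ)
  rw [sub_add_cancel] at h3
  linarith

theorem AntitoneOn.exists_tendsto_atBot {f : ℝ → ℝ} {S T B : ℝ} (hf : AntitoneOn f (Iio T))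
    (hST : S ≤ T) (hB : ∀ t < S, f t ≤ B) :
    ∃ l, Tendsto f atBot (𝓝 l) ∧ ∀ t < T, f t ≤ l := by
  have hlt : ∀ t, min t (S - 1) < S := fun t => (min_le_right _ _).trans_lt (by linarith)
  have hanti : Antitone fun t => f (min t (S - 1)) := fun x y hxy =>
    hf ((hlt x).trans_le hST) ((hlt y).trans_le hST) (min_le_min_right _ hxy)
  have hbdd : BddAbove (range fun t => f (min t (S - 1))) := by
    refine ⟨B, ?_⟩
    rintro _ ⟨t, rfl⟩
    exact hB _ (hlt t)
  have htend : Tendsto f atBot (𝓝 (⨆ t, f (min t (S - 1)))) := by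
    refine (tendsto_atBot_ciSup hanti hbdd).congr' ?_
    filter_upwards [eventually_le_atBot (S - 1)] with t ht
    rw [min_eq_left ht]
  refine ⟨_, htend, fun t ht => ge_of_tendsto htend ?_⟩
  filter_upwards [eventually_le_atBot t] with x hx
  exact hf (hx.trans_lt ht) ht hx

/-- The potential `x ^ (p + 1) / (p + 1) - l ^ (p - 1) * x ^ 2 / 2` has its strict minimum over the
positive reals at `l`. -/
theorem potential_eq_of_le {p l x : ℝ} (hp : 1 < p) (hl : 0 < l) (hx : 0 < x)
    (h : x ^ (p + 1) / (p + 1) - l ^ (p - 1) * x ^ 2 / 2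
      ≤ l ^ (p + 1) / (p + 1) - l ^ (p - 1) * l ^ 2 / 2) : x = l := by
  by_contra hne
  have hy : 0 < x / l := by positivity
  have hs : (x / l) ^ 2 - 1 ≠ 0 := by
    intro h0
    have : x / l = 1 := by nlinarith
    exact hne ((div_eq_one_iff_eq hl.ne').1 this)
  have hb := one_add_mul_self_lt_rpow_one_add (s := (x / l) ^ 2 - 1) (p := (p + 1) / 2)
    (by nlinarith [sq_nonneg (x / l)]) hs (by linarith)
  have e1 : (1 + ((x / l) ^ 2 - 1)) ^ ((p + 1) / 2) = x ^ (p + 1) / l ^ (p + 1) := by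
    rw [add_sub_cancel, ← Real.rpow_natCast, ← Real.rpow_mul hy.le, ← Real.div_rpow hx.le hl.le]
    congr 1
    push_cast
    ring
  have e2 : l ^ (p + 1) = l ^ (p - 1) * l ^ 2 := by
    rw [← Real.rpow_natCast, ← Real.rpow_add hl]
    congr 1
    push_cast
    ring
  have hlp : 0 < l ^ (p - 1) := Real.rpow_pos_of_pos hl _
  rw [e1, e2, lt_div_iff₀ (by positivity)] at hb
  have e3 : (1 + (p + 1) / 2 * ((x / l) ^ 2 - 1)) * (l ^ (p - 1) * l ^ 2)
      = l ^ (p - 1) * l ^ 2 + (p + 1) / 2 * (l ^ (p - 1) * x ^ 2 - l ^ (p - 1) * l ^ 2) := by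
    field_simp
  rw [e3] at hb
  rw [e2] at h
  have hp1 : 0 < p + 1 := by linarith
  have h2 := mul_le_mul_of_nonneg_left h hp1.le
  field_simp at h2
  nlinarith

/-- An orbit of `w'' + a w' - b w + w ^ p = 0` that stays positive and is bounded
near `-∞` is either constant or tends to zero at `-∞` with nonpositive energy. -/
theorem damped_orbit_dichotomy {w w₁ : ℝ → ℝ} {a b p T S M L : ℝ} (ha : 0 < a) (hb : 0 < b)
    (hp : 1 < p) (hST : S ≤ T) (hpos : ∀ t < T, 0 < w t)
    (hw : ∀ t < T, HasDerivAt w (w₁ t) t)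
    (hw₁ : ∀ t < T, HasDerivAt w₁ (-a * w₁ t + b * w t - w t ^ p) t)
    (hM : ∀ t < S, w t ≤ M) (hL : ∀ t < S, |w₁ t| ≤ L) :
    (∀ t < T, w t = b ^ (1 / (p - 1))) ∨
      (Tendsto w atBot (𝓝 0) ∧ ∀ t < T, w₁ t ^ 2 ≤ b * w t ^ 2) := by
  set E : ℝ → ℝ := fun t => w₁ t ^ 2 / 2 - b * w t ^ 2 / 2 + w t ^ (p + 1) / (p + 1) with hE
  have hp1 : 0 < p + 1 := by linarith
  have hEd : ∀ t < T, HasDerivAt E (-a * w₁ t ^ 2) t := by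
    intro t ht
    have h1 := ((hw₁ t ht).pow 2).div_const 2
    have h2 := (((hw t ht).pow 2).const_mul b).div_const 2
    have h3 := ((hw t ht).rpow_const (p := p + 1) (Or.inl (hpos t ht).ne')).div_const (p + 1)
    refine ((h1.sub h2).add h3).congr_deriv ?_
    rw [add_sub_cancel_right]
    field_simp
    ring
  have hEanti : AntitoneOn E (Iio T) :=
    antitoneOn_of_hasDerivAt_nonpos (convex_Iio T) hEd (fun t _ => by nlinarith [sq_nonneg (w₁ t)])
  have hL0 : 0 ≤ L := (abs_nonneg _).trans (hL (S - 1) (by linarith))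
  have hM0 : 0 < M := (hpos (S - 1) (by linarith)).trans_le (hM (S - 1) (by linarith))
  have hw1sq : ∀ t < S, w₁ t ^ 2 ≤ L ^ 2 := fun t ht => sq_le_sq' (abs_le.1 (hL t ht)).1
    (abs_le.1 (hL t ht)).2
  have hwp : ∀ t < S, w t ^ p ≤ M ^ p := fun t ht =>
    Real.rpow_le_rpow (hpos t (ht.trans_le hST)).le (hM t ht) (by linarith)
  have hwp0 : ∀ t < S, 0 ≤ w t ^ p := fun t ht =>
    Real.rpow_nonneg (hpos t (ht.trans_le hST)).le _
  obtain ⟨e, he, hEle⟩ := hEanti.exists_tendsto_atBot hST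
    (B := L ^ 2 / 2 + M ^ (p + 1) / (p + 1)) (by
      intro t ht
      have h0 := hpos t (ht.trans_le hST)
      have h1 : w t ^ (p + 1) / (p + 1) ≤ M ^ (p + 1) / (p + 1) := by
        have := Real.rpow_le_rpow h0.le (hM t ht) hp1.le
        gcongr
      have := hw1sq t ht
      have h2 : 0 ≤ b * w t ^ 2 := by positivity
      simp only [hE]
      linarith)
  set w₂ : ℝ → ℝ := fun t => -a * w₁ t + b * w t - w t ^ p with hw₂
  have hw₂b : ∀ t < S, |w₂ t| ≤ a * L + b * M + M ^ p := by
    intro t ht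
    have h0 := hpos t (ht.trans_le hST)
    have h1 := abs_le.1 (hL t ht)
    have h2 := mul_le_mul_of_nonneg_left (hM t ht) hb.le
    have h3 := mul_le_mul_of_nonneg_left h1.1 ha.le
    have h4 := mul_le_mul_of_nonneg_left h1.2 ha.le
    have h5 : 0 < b * w t := by positivity
    have h6 := hwp t ht
    have h7 := hwp0 t ht
    simp only [hw₂]
    rw [abs_le]
    constructor <;> linarith
  set K := a * L + b * M + M ^ p with hK
  have hK0 : 0 ≤ K := (abs_nonneg _).trans (hw₂b (S - 1) (by linarith))
  have hsq : Tendsto (fun t => -a * w₁ t ^ 2) atBot (𝓝 0) := by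
    refine tendsto_deriv_atBot_zero (T := S) (h := fun t => -a * (2 * w₁ t * w₂ t))
      (L := a * (2 * L * K))
      (fun t ht => hEd t (ht.trans_le hST)) (fun t ht => ?_) (fun t ht => ?_) he
    · refine (((hw₁ t (ht.trans_le hST)).pow 2).const_mul (-a)).congr_deriv ?_
      simp only [hw₂]
      ring
    · rw [abs_mul, abs_mul, abs_mul, abs_neg, abs_of_pos ha, abs_two]
      have := hL t ht
      have := hw₂b t ht
      gcongr
  have hsq0 : Tendsto (fun t => w₁ t ^ 2) atBot (𝓝 0) := by
    have := hsq.const_mul (-a)⁻¹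
    simpa [ha.ne'] using this
  have hw₁0 : Tendsto w₁ atBot (𝓝 0) := by
    rw [tendsto_zero_iff_abs_tendsto_zero]
    have := (Real.continuous_sqrt.tendsto 0).comp hsq0
    simpa [Function.comp_def, Real.sqrt_sq_eq_abs] using this
  have hw₂0 : Tendsto w₂ atBot (𝓝 0) := by
    refine tendsto_deriv_atBot_zero (T := S)
      (h := fun t => -a * w₂ t + b * w₁ t - w₁ t * p * w t ^ (p - 1))
      (L := a * K + b * L + L * p * M ^ (p - 1))
      (fun t ht => hw₁ t (ht.trans_le hST)) (fun t ht => ?_) (fun t ht => ?_) hw₁0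
    · have ht' := ht.trans_le hST
      exact (((hw₁ t ht').const_mul (-a)).add ((hw t ht').const_mul b)).sub
        ((hw t ht').rpow_const (p := p) (Or.inl (hpos t ht').ne'))
    · have h0 := hpos t (ht.trans_le hST)
      have h1 := hL t ht
      have h2 := hw₂b t ht
      have h3 : w t ^ (p - 1) ≤ M ^ (p - 1) :=
        Real.rpow_le_rpow h0.le (hM t ht) (by linarith)
      have h4 : 0 ≤ w t ^ (p - 1) := Real.rpow_nonneg h0.le _
      refine (abs_sub _ _).trans (add_le_add ((abs_add_le _ _).trans (add_le_add ?_ ?_)) ?_)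
      · rw [abs_mul, abs_neg, abs_of_pos ha]
        gcongr
      · rw [abs_mul, abs_of_pos hb]
        gcongr
      · rw [abs_mul, abs_mul, abs_of_pos (zero_lt_one.trans hp), abs_of_nonneg h4]
        gcongr
  have hres : Tendsto (fun t => b * w t - w t ^ p) atBot (𝓝 0) := by
    have := hw₂0.add (hw₁0.const_mul a)
    simp only [mul_zero, add_zero] at this
    refine this.congr fun t => ?_
    simp only [hw₂]
    ring
  have hp1m : 0 < p - 1 := by linarith
  set D := b * (p - 1) / (2 * (p + 1)) with hD
  have hD0 : 0 < D := by positivity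
  have hwS : ∀ᶠ t in atBot, t < S := eventually_lt_atBot S
  have hbdd : IsBoundedUnder (· ≤ ·) atBot fun t => |w t| := by
    refine ⟨M, eventually_map.2 ?_⟩
    filter_upwards [hwS] with t ht
    rw [abs_of_pos (hpos t (ht.trans_le hST))]
    exact hM t ht
  have hres2 : Tendsto (fun t => (b * w t - w t ^ p) * w t) atBot (𝓝 0) :=
    hres.zero_mul_isBoundedUnder_le hbdd
  have hwsq : Tendsto (fun t => w t ^ 2) atBot (𝓝 (D⁻¹ * (-e))) := by
    have := ((hsq0.div_const 2).sub he).sub (hres2.div_const (p + 1)) |>.const_mul D⁻¹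
    simp only [zero_div, zero_sub, sub_zero] at this
    refine this.congr' ?_
    filter_upwards [hwS] with t ht
    have h0 := hpos t (ht.trans_le hST)
    have h1 : w t ^ (p + 1) = w t ^ p * w t := by
      rw [Real.rpow_add h0, Real.rpow_one]
    simp only [hE, h1, hD]
    field_simp
    ring
  obtain ⟨l, hl0, hl⟩ : ∃ l, 0 ≤ l ∧ Tendsto w atBot (𝓝 l) := by
    refine ⟨_, Real.sqrt_nonneg _, ((Real.continuous_sqrt.tendsto _).comp hwsq).congr' ?_⟩
    filter_upwards [hwS] with t ht
    exact Real.sqrt_sq (hpos t (ht.trans_le hST)).le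
  have hlres : b * l - l ^ p = 0 :=
    tendsto_nhds_unique ((hl.const_mul b).sub (hl.rpow_const (Or.inr (by linarith)))) hres
  have hel : e = - b * l ^ 2 / 2 + l ^ (p + 1) / (p + 1) := by
    have := ((hsq0.div_const 2).sub (((hl.pow 2).const_mul b).div_const 2)).add
      ((hl.rpow_const (p := p + 1) (Or.inr hp1.le)).div_const (p + 1))
    rw [tendsto_nhds_unique he this]
    ring
  rcases hl0.eq_or_lt with h0 | h0
  · right
    refine ⟨by rwa [← h0] at hl, fun t ht => ?_⟩
    have h1 := hEle t ht
    rw [hel, ← h0, Real.zero_rpow hp1.ne'] at h1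
    have h2 : 0 ≤ w t ^ (p + 1) / (p + 1) := div_nonneg (Real.rpow_nonneg (hpos t ht).le _) hp1.le
    simp only [hE, zero_div, ne_eq, OfNat.ofNat_ne_zero, not_false_eq_true, zero_pow, mul_zero,
      add_zero] at h1
    linarith
  · left
    intro t ht
    have hbl : b = l ^ (p - 1) := by
      rw [Real.rpow_sub_one h0.ne', eq_div_iff h0.ne']
      linarith
    have hwl : w t = l := by
      apply potential_eq_of_le hp h0 (hpos t ht)
      have h1 := hEle t ht
      rw [hel] at h1
      simp only [hE] at h1
      rw [← hbl]
      nlinarith [sq_nonneg (w₁ t)]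
    rw [hwl, hbl, ← Real.rpow_mul h0.le, mul_one_div_cancel hp1m.ne', Real.rpow_one]

/-- An orbit of `w'' + a w' - m (m + a) w + w ^ p = 0` that vanishes at `-∞` does so at the rate of
the unstable eigenvalue `m`. -/
theorem exists_le_mul_exp_of_tendsto_zero {w w₁ : ℝ → ℝ} {a m p T : ℝ} (ha : 0 < a) (hm : 0 < m)
    (hp : 1 < p) (hpos : ∀ t < T, 0 < w t)
    (hw : ∀ t < T, HasDerivAt w (w₁ t) t)
    (hw₁ : ∀ t < T, HasDerivAt w₁ (-a * w₁ t + m * (m + a) * w t - w t ^ p) t)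
    (hw₁m : ∀ t < T, w₁ t ≤ m * w t)
    (hsq : ∀ t < T, w₁ t ^ 2 ≤ m * (m + a) * w t ^ 2) (hlim : Tendsto w atBot (𝓝 0)) :
    ∃ B, ∀ᶠ t in atBot, w t ≤ B * Real.exp (m * t) := by
  set β := Real.sqrt (m * (m + a)) with hβ
  have hβ0 : 0 ≤ β := Real.sqrt_nonneg _
  have hβsq : β ^ 2 = m * (m + a) := Real.sq_sqrt (by positivity)
  have hβlt : β < m + a := by nlinarith
  set c := m + a - β with hc
  have hc0 : 0 < c := sub_pos.2 hβlt
  have hp1 : 0 < p - 1 := by linarith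
  set z : ℝ → ℝ := fun t => m - w₁ t / w t with hz
  set q : ℝ → ℝ := fun t => w t ^ (p - 1) with hq
  have hq0 : ∀ t < T, 0 < q t := fun t ht => Real.rpow_pos_of_pos (hpos t ht) _
  have hz0 : ∀ t < T, 0 ≤ z t := fun t ht => sub_nonneg.2 ((div_le_iff₀ (hpos t ht)).2 (hw₁m t ht))
  have hzβ : ∀ t < T, z t ≤ m + β := by
    intro t ht
    have h0 := hpos t ht
    have h1 : |w₁ t / w t| ≤ β := by
      apply Real.abs_le_sqrt
      rw [div_pow, div_le_iff₀ (by positivity)]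
      exact hsq t ht
    have := (abs_le.1 h1).1
    simp only [hz]
    linarith
  have hwp : ∀ t < T, w t ^ p = q t * w t := by
    intro t ht
    have h0 := hpos t ht
    simp only [hq]
    rw [Real.rpow_sub_one h0.ne', div_mul_cancel₀ _ h0.ne']
  have hzd : ∀ t < T, HasDerivAt z (q t - z t * (2 * m + a - z t)) t := by
    intro t ht
    have h0 := hpos t ht
    refine (((hw₁ t ht).div (hw t ht) h0.ne').const_sub m).congr_deriv ?_
    rw [hwp t ht]
    simp only [hz]
    field_simp
    ring
  have hqd : ∀ t < T, HasDerivAt q ((p - 1) * (m - z t) * q t) t := by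
    intro t ht
    have h0 := hpos t ht
    refine ((hw t ht).rpow_const (p := p - 1) (Or.inl h0.ne')).congr_deriv ?_
    rw [Real.rpow_sub_one h0.ne']
    simp only [hz, hq]
    field_simp
    ring
  have hq_lim : Tendsto q atBot (𝓝 0) := by
    have := hlim.rpow_const (p := p - 1) (Or.inr hp1.le)
    rwa [Real.zero_rpow hp1.ne'] at this
  obtain ⟨S, hS⟩ := eventually_atBot.1
    ((hq_lim.eventually_lt_const (show 0 < c * (m / 2) by positivity)).and
      (eventually_lt_atBot T))
  have hzm : ∀ t < S, z t ≤ m / 2 := by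
    intro t₀ ht₀
    have hanti := antitoneOn_of_hasDerivAt_nonpos (convex_Iio S)
      (f := fun t => Real.exp (c * t) * (z t - m / 2))
      (f' := fun t => Real.exp (c * t) * (c * (z t - m / 2) + (q t - z t * (2 * m + a - z t))))
      (fun t ht => by
        refine (((hasDerivAt_id' t).const_mul c).exp.mul
          ((hzd t (hS t ht.le).2).sub_const (m / 2))).congr_deriv ?_
        ring)
      (fun t ht => by
        obtain ⟨h1, h2⟩ := hS t ht.le
        refine mul_nonpos_of_nonneg_of_nonpos (Real.exp_pos _).le ?_
        nlinarith [hz0 t h2, hzβ t h2])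
    have h := nonpos_of_forall_le_mul_exp (A := Real.exp (c * t₀) * (z t₀ - m / 2))
      (B := m + β) (T := t₀) hc0 (fun t ht => by
        have hS' := ht.trans ht₀
        refine (hanti hS' ht₀ ht.le).trans ?_
        rw [mul_comm (m + β)]
        refine mul_le_mul_of_nonneg_left ?_ (Real.exp_pos _).le
        linarith [hzβ t (hS t hS'.le).2])
    exact sub_nonpos.1 (nonpos_of_mul_nonpos_right h (Real.exp_pos _))
  set κ := 2 / (c * (p - 1) * m) with hκ
  have hκ0 : 0 < κ := by positivity
  have hmono := monotoneOn_of_hasDerivAt_nonneg (convex_Iio S)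
    (f := fun t => Real.log (w t) - m * t - z t / c + κ * q t)
    (f' := fun t => -z t - (q t - z t * (2 * m + a - z t)) / c + κ * ((p - 1) * (m - z t) * q t))
    (fun t ht => by
      obtain ⟨-, h2⟩ := hS t ht.le
      refine (((((hw t h2).log (hpos t h2).ne').sub ((hasDerivAt_id' t).const_mul m)).sub
        ((hzd t h2).div_const c)).add ((hqd t h2).const_mul κ)).congr_deriv ?_
      simp only [hz]
      ring)
    (fun t ht => by
      obtain ⟨-, h2⟩ := hS t ht.le
      have h3 : z t * c ≤ z t * (2 * m + a - z t) :=
        mul_le_mul_of_nonneg_left (by linarith [hzβ t h2]) (hz0 t h2)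
      have h4 : q t / c ≤ κ * ((p - 1) * (m - z t) * q t) := by
        have h5 : q t / c = κ * ((p - 1) * (m / 2) * q t) := by
          rw [hκ]
          field_simp
        rw [h5]
        have := hq0 t h2
        have := hzm t ht
        gcongr
        linarith
      have h6 := (le_div_iff₀ hc0).2 h3
      rw [sub_div]
      linarith)
  set Φ : ℝ := Real.log (w (S - 1)) - m * (S - 1) - z (S - 1) / c + κ * q (S - 1) with hΦ
  refine ⟨Real.exp (Φ + (m + β) / c), ?_⟩
  filter_upwards [eventually_lt_atBot (S - 1)] with t ht
  have htS : t < S := by linarith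
  have h2 := (hS t htS.le).2
  have h := hmono htS (show S - 1 < S by linarith) ht.le
  simp only [← hΦ] at h
  have h3 : z t / c ≤ (m + β) / c := by
    have := hzβ t h2
    gcongr
  have h4 : 0 < κ * q t := mul_pos hκ0 (hq0 t h2)
  rw [← Real.exp_add, ← Real.log_le_iff_le_exp (hpos t h2)]
  linarith

section EmdenFowler

variable {u u₁ : ℝ → ℝ} {n s p T : ℝ}

theorem emdenFowler_deriv_nonpos (hn : 0 < n)
    (hpos : ∀ t < T, 0 < u t) (hu : ∀ t < T, HasDerivAt u (u₁ t) t)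
    (hu₁ : ∀ t < T, HasDerivAt u₁ (-n * u₁ t - Real.exp (s * t) * u t ^ p) t) :
    ∀ t < T, u₁ t ≤ 0 := by
  intro t₀ ht₀
  by_contra! hlt
  have hanti := antitoneOn_of_hasDerivAt_nonpos (convex_Iio T)
    (f := fun t => Real.exp (n * t) * u₁ t)
    (f' := fun t => -(Real.exp (n * t) * (Real.exp (s * t) * u t ^ p)))
    (fun t ht => by
      refine (((hasDerivAt_id' t).const_mul n).exp.mul (hu₁ t ht)).congr_deriv ?_
      ring)
    (fun t ht => by
      have := hpos t ht
      have : 0 ≤ Real.exp (n * t) * (Real.exp (s * t) * u t ^ p) := by positivity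
      linarith)
  have hge : ∀ t ≤ t₀, u₁ t₀ ≤ u₁ t := by
    intro t ht
    have h1 : Real.exp (n * t₀) * u₁ t₀ ≤ Real.exp (n * t) * u₁ t :=
      hanti (ht.trans_lt ht₀) ht₀ ht
    have h2 : Real.exp (n * t) ≤ Real.exp (n * t₀) := Real.exp_le_exp.2 (by gcongr)
    have h3 : Real.exp (n * t) * u₁ t₀ ≤ Real.exp (n * t) * u₁ t :=
      (mul_le_mul_of_nonneg_right h2 hlt.le).trans h1
    exact le_of_mul_le_mul_left h3 (Real.exp_pos _)
  have hmono := monotoneOn_of_hasDerivAt_nonneg (convex_Iic t₀)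
    (f := fun t => u t - u₁ t₀ * t) (f' := fun t => u₁ t - u₁ t₀)
    (fun t ht => ((hu t (lt_of_le_of_lt ht ht₀)).sub
      ((hasDerivAt_id' t).const_mul (u₁ t₀))).congr_deriv (by ring))
    (fun t ht => sub_nonneg.2 (hge t ht))
  have h0 := hpos t₀ ht₀
  have hle : t₀ - u t₀ / u₁ t₀ ≤ t₀ := sub_le_self _ (by positivity)
  have h1 : u (t₀ - u t₀ / u₁ t₀) - u₁ t₀ * (t₀ - u t₀ / u₁ t₀) ≤ u t₀ - u₁ t₀ * t₀ :=
    hmono hle (le_refl t₀) hle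
  rw [mul_sub, mul_div_cancel₀ _ hlt.ne'] at h1
  linarith [hpos _ (hle.trans_lt ht₀)]

theorem emdenFowler_le_neg_deriv (hn : 0 < n) (hs : 0 < s) (hp : 1 < p)
    (hpos : ∀ t < T, 0 < u t) (hu : ∀ t < T, HasDerivAt u (u₁ t) t)
    (hu₁ : ∀ t < T, HasDerivAt u₁ (-n * u₁ t - Real.exp (s * t) * u t ^ p) t) :
    ∀ t < T, u t ^ p * Real.exp (s * t) / (n + s) ≤ -u₁ t := by
  intro t ht
  have hneg := emdenFowler_deriv_nonpos hn hpos hu hu₁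
  have hanti := antitoneOn_of_hasDerivAt_nonpos (convex_Iio T) hu hneg
  have hns : 0 < n + s := by positivity
  have hmono := monotoneOn_of_hasDerivAt_nonneg (convex_Iic t)
    (f := fun x => -(Real.exp (n * x) * u₁ x) - u t ^ p * Real.exp ((n + s) * x) / (n + s))
    (f' := fun x => Real.exp ((n + s) * x) * (u x ^ p - u t ^ p))
    (fun x hx => by
      refine ((((hasDerivAt_id' x).const_mul n).exp.mul (hu₁ x (lt_of_le_of_lt hx ht))).neg.sub
        ((((hasDerivAt_id' x).const_mul (n + s)).exp.const_mul (u t ^ p)).div_const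
          (n + s))).congr_deriv ?_
      rw [show (n + s) * x = n * x + s * x by ring, Real.exp_add]
      field_simp
      ring)
    (fun x hx => by
      refine mul_nonneg (Real.exp_pos _).le (sub_nonneg.2 ?_)
      exact Real.rpow_le_rpow (hpos t ht).le (hanti (lt_of_le_of_lt hx ht) ht hx) (by linarith))
  have hlim := nonpos_of_forall_le_mul_exp (T := t) (c := n + s) (B := u t ^ p / (n + s))
    (A := u t ^ p * Real.exp ((n + s) * t) / (n + s) - -(Real.exp (n * t) * u₁ t)) hns
    (fun x hx => by
      have h1 := hmono hx.le (le_refl t) hx.le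
      have h2 := mul_nonneg (Real.exp_pos (n * x)).le (neg_nonneg.2 (hneg x (hx.trans ht)))
      simp only at h1
      rw [div_mul_eq_mul_div]
      linarith)
  rw [show (n + s) * t = n * t + s * t by ring, Real.exp_add] at hlim
  refine le_of_mul_le_mul_left ?_ (Real.exp_pos (n * t))
  have : Real.exp (n * t) * (u t ^ p * Real.exp (s * t) / (n + s))
    = u t ^ p * (Real.exp (n * t) * Real.exp (s * t)) / (n + s) := by ring
  linarith

theorem emdenFowler_exists_le {m : ℝ} (hn : 0 < n) (hm : 0 < m) (hp : 1 < p)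
    (hs : s = m * (p - 1)) (hpos : ∀ t < T, 0 < u t) (hu : ∀ t < T, HasDerivAt u (u₁ t) t)
    (hu₁ : ∀ t < T, HasDerivAt u₁ (-n * u₁ t - Real.exp (s * t) * u t ^ p) t) :
    ∃ M, ∀ t < T, Real.exp (m * t) * u t ≤ M := by
  have hp1 : 0 < p - 1 := by linarith
  have hs0 : 0 < s := hs ▸ mul_pos hm hp1
  have hle := emdenFowler_le_neg_deriv hn hs0 hp hpos hu hu₁
  set κ := (p - 1) / ((n + s) * s) with hκ
  have hκ0 : 0 < κ := by positivity
  have hmono := monotoneOn_of_hasDerivAt_nonneg (convex_Iio T)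
    (f := fun t => u t ^ (1 - p) - κ * Real.exp (s * t))
    (f' := fun t => (p - 1) * ((-u₁ t) / u t ^ p - Real.exp (s * t) / (n + s)))
    (fun t ht => by
      have h0 := hpos t ht
      refine (((hu t ht).rpow_const (p := 1 - p) (Or.inl h0.ne')).sub
        (((hasDerivAt_id' t).const_mul s).exp.const_mul κ)).congr_deriv ?_
      rw [show 1 - p - 1 = -p by ring, Real.rpow_neg h0.le, hκ]
      field_simp
      ring)
    (fun t ht => by
      have h0 := Real.rpow_pos_of_pos (hpos t ht) p
      refine mul_nonneg hp1.le (sub_nonneg.2 ((le_div_iff₀ h0).2 ?_))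
      have := hle t ht
      calc _ = _ := by ring
        _ ≤ _ := this)
  refine ⟨κ⁻¹ ^ (p - 1)⁻¹, fun t ht => ?_⟩
  have h0 := hpos t ht
  have hlim := nonpos_of_forall_le_mul_exp (T := t) (c := s) (B := κ)
    (A := κ * Real.exp (s * t) - u t ^ (1 - p)) hs0 (fun x hx => by
      have h1 := hmono (hx.trans ht) ht hx.le
      have h2 := Real.rpow_nonneg (hpos x (hx.trans ht)).le (1 - p)
      simp only at h1
      linarith)
  rw [Real.le_rpow_inv_iff_of_pos (by positivity) (by positivity) hp1,
    Real.mul_rpow (Real.exp_pos _).le h0.le, ← Real.exp_mul,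
    show m * t * (p - 1) = s * t by rw [hs]; ring, le_inv_comm₀ (by positivity) hκ0]
  rw [show 1 - p = -(p - 1) by ring, Real.rpow_neg h0.le] at hlim
  rw [mul_inv, ← div_eq_inv_mul, le_div_iff₀ (Real.exp_pos _)]
  linarith

theorem emdenFowler_exists_neg_deriv_le {m M : ℝ} (hmn : m < n)
    (hpos : ∀ t < T, 0 < u t) (hu : ∀ t < T, HasDerivAt u (u₁ t) t)
    (hu₁ : ∀ t < T, HasDerivAt u₁ (-n * u₁ t - Real.exp (s * t) * u t ^ p) t)
    (hM : ∀ t < T, Real.exp (m * t) * u t ≤ M) :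
    ∃ S ≤ T, ∀ t < S, -(n * u t) ≤ u₁ t := by
  have hanti := antitoneOn_of_hasDerivAt_nonpos (convex_Iio T)
    (f := fun t => u₁ t + n * u t)
    (f' := fun t => -(Real.exp (s * t) * u t ^ p))
    (fun t ht => ((hu₁ t ht).add ((hu t ht).const_mul n)).congr_deriv (by ring))
    (fun t ht => by
      have := hpos t ht
      have : 0 ≤ Real.exp (s * t) * u t ^ p := by positivity
      linarith)
  by_cases hex : ∃ S < T, 0 ≤ u₁ S + n * u S
  · obtain ⟨S, hST, hS⟩ := hex
    refine ⟨S, hST.le, fun t ht => ?_⟩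
    have h1 := hanti (ht.trans hST) hST ht.le
    simp only at h1
    linarith
  · exfalso
    push Not at hex
    have hanti' := antitoneOn_of_hasDerivAt_nonpos (convex_Iio T)
      (f := fun t => Real.exp (n * t) * u t)
      (f' := fun t => Real.exp (n * t) * (u₁ t + n * u t))
      (fun t ht => (((hasDerivAt_id' t).const_mul n).exp.mul (hu t ht)).congr_deriv (by ring))
      (fun t ht => mul_nonpos_of_nonneg_of_nonpos (Real.exp_pos _).le (hex t ht).le)
    have hT : T - 1 < T := by linarith
    have hlim := nonpos_of_forall_le_mul_exp (T := T - 1) (c := n - m) (B := M)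
      (A := Real.exp (n * (T - 1)) * u (T - 1)) (sub_pos.2 hmn) (fun t ht => by
        have htT := ht.trans hT
        refine (hanti' htT hT ht.le).trans ?_
        have h1 := mul_le_mul_of_nonneg_right (hM t htT) (Real.exp_pos ((n - m) * t)).le
        refine le_trans (le_of_eq ?_) h1
        rw [mul_right_comm, ← Real.exp_add, show m * t + (n - m) * t = n * t by ring])
    have := hpos (T - 1) hT
    have : 0 < Real.exp (n * (T - 1)) * u (T - 1) := by positivity
    linarith

theorem emdenFowler_eq_of_frequently {m : ℝ} (hm : 0 < m) (hmn : 2 * m < n) (hp : 1 < p)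
    (hs : s = m * (p - 1)) (hpos : ∀ t < T, 0 < u t) (hu : ∀ t < T, HasDerivAt u (u₁ t) t)
    (hu₁ : ∀ t < T, HasDerivAt u₁ (-n * u₁ t - Real.exp (s * t) * u t ^ p) t)
    (hfreq : ∀ M, ∃ᶠ t in atBot, M < u t) :
    ∀ t < T, Real.exp (m * t) * u t = (m * (n - m)) ^ (1 / (p - 1)) := by
  have hn : 0 < n := by linarith
  have hneg := emdenFowler_deriv_nonpos hn hpos hu hu₁
  obtain ⟨M, hM⟩ := emdenFowler_exists_le hn hm hp hs hpos hu hu₁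
  obtain ⟨S, hST, hS⟩ := emdenFowler_exists_neg_deriv_le (by linarith) hpos hu hu₁ hM
  set w : ℝ → ℝ := fun t => Real.exp (m * t) * u t with hw
  set w₁ : ℝ → ℝ := fun t => Real.exp (m * t) * (m * u t + u₁ t) with hw₁
  have hwpos : ∀ t < T, 0 < w t := fun t ht => mul_pos (Real.exp_pos _) (hpos t ht)
  have hwd : ∀ t < T, HasDerivAt w (w₁ t) t := fun t ht =>
    (((hasDerivAt_id' t).const_mul m).exp.mul (hu t ht)).congr_deriv (by simp only [hw₁]; ring)
  have hw₁d : ∀ t < T, HasDerivAt w₁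
      (-(n - 2 * m) * w₁ t + m * (m + (n - 2 * m)) * w t - w t ^ p) t := by
    intro t ht
    refine (((hasDerivAt_id' t).const_mul m).exp.mul
      (((hu t ht).const_mul m).add (hu₁ t ht))).congr_deriv ?_
    simp only [hw, hw₁, Pi.add_apply]
    rw [Real.mul_rpow (Real.exp_pos _).le (hpos t ht).le, ← Real.exp_mul,
      show m * t * p = m * t + s * t by rw [hs]; ring, Real.exp_add]
    ring
  have hw₁le : ∀ t < T, w₁ t ≤ m * w t := by
    intro t ht
    have := mul_nonpos_of_nonneg_of_nonpos (Real.exp_pos (m * t)).le (hneg t ht)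
    simp only [hw, hw₁]
    linarith
  have hw₁abs : ∀ t < S, |w₁ t| ≤ n * M := by
    intro t ht
    have htT := ht.trans_le hST
    have h1 := mul_le_mul_of_nonneg_left (hS t ht) (Real.exp_pos (m * t)).le
    have h2 := hw₁le t htT
    have h3 := mul_le_mul_of_nonneg_left (hM t htT) hn.le
    have h4 := hwpos t htT
    have h5 := mul_pos hm h4
    have h6 : m * w t ≤ n * w t := by nlinarith
    have h7 : -(n * w t) ≤ w₁ t := by
      simp only [hw, hw₁] at h5 ⊢
      linarith
    exact abs_le.2 ⟨by linarith, by linarith⟩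
  rcases damped_orbit_dichotomy (by linarith)
    (mul_pos hm (by linarith : 0 < m + (n - 2 * m))) hp hST hwpos hwd hw₁d
    (fun t ht => hM t (ht.trans_le hST)) hw₁abs with h | ⟨h, h'⟩
  · intro t ht
    rw [show m * (n - m) = m * (m + (n - 2 * m)) by ring]
    exact h t ht
  · exfalso
    obtain ⟨B, hB⟩ := exists_le_mul_exp_of_tendsto_zero (by linarith) hm hp hwpos hwd hw₁d
      hw₁le h' h
    refine hfreq B (hB.mono fun t ht => not_lt.2 ?_)
    simp only [hw] at ht
    rw [mul_comm] at ht
    exact le_of_mul_le_mul_right ht (Real.exp_pos _)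

end EmdenFowler

/-- Theorem 4.3, uniqueness of the singular radial solution.
Let `N' > 2`, `τ > -2` and `p > (N'+2+2τ)/(N'-2)`. If `v ∈ C²((0,R))` is a positive
solution of `v'' + ((N'-1)/r) v' + r^τ v^p = 0` on `(0,R)` with
`limsup_{r→0+} v(r) = ∞`, then `v(r) = C₀ r^{-(2+τ)/(p-1)}` on `(0,R)`, where
`C₀ = [((2+τ)/(p-1))(N'-2-(2+τ)/(p-1))]^{1/(p-1)}`. -/
theorem stmt_14 (N' τ p R : ℝ) (hN' : 2 < N') (hτ : -2 < τ)
    (hp : (N' + 2 + 2 * τ) / (N' - 2) < p) (hR : 0 < R)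
    (v : ℝ → ℝ)
    (hsm : ContDiffOn ℝ 2 v (Set.Ioo 0 R))
    (hpos : ∀ r ∈ Set.Ioo (0 : ℝ) R, 0 < v r)
    (hode : ∀ r ∈ Set.Ioo (0 : ℝ) R,
      deriv (deriv v) r + (N' - 1) / r * deriv v r + r ^ τ * v r ^ p = 0)
    (hsing : ∀ M : ℝ, ∃ᶠ r in nhdsWithin (0 : ℝ) (Set.Ioi 0), M < v r) :
    ∀ r ∈ Set.Ioo (0 : ℝ) R,
      v r = ((2 + τ) / (p - 1) * (N' - 2 - (2 + τ) / (p - 1))) ^ (1 / (p - 1))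
              * r ^ (-(2 + τ) / (p - 1)) := by
  have hn : 0 < N' - 2 := by linarith
  rw [div_lt_iff₀ hn] at hp
  have hp1 : 1 < p := by nlinarith
  have hp10 : 0 < p - 1 := by linarith
  have hm : 0 < (2 + τ) / (p - 1) := div_pos (by linarith) hp10
  have hmn : 2 * ((2 + τ) / (p - 1)) < N' - 2 := by
    rw [mul_div_assoc', div_lt_iff₀ hp10]
    linarith
  have hs : 2 + τ = (2 + τ) / (p - 1) * (p - 1) := (div_mul_cancel₀ _ hp10.ne').symm
  have hmem : ∀ t < Real.log R, Real.exp t ∈ Ioo 0 R := fun t ht =>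
    ⟨Real.exp_pos t, (Real.lt_log_iff_exp_lt hR).1 ht⟩
  have hv : ∀ r ∈ Ioo 0 R, HasDerivAt v (deriv v r) r := fun r hr =>
    ((hsm.differentiableOn (by norm_num)).differentiableAt
      (isOpen_Ioo.mem_nhds hr)).hasDerivAt
  have hv' : ∀ r ∈ Ioo 0 R, HasDerivAt (deriv v) (deriv (deriv v) r) r := fun r hr =>
    (((hsm.deriv_of_isOpen (m := 1) isOpen_Ioo (by norm_num)).differentiableOn
      (by norm_num)).differentiableAt (isOpen_Ioo.mem_nhds hr)).hasDerivAt
  have key := emdenFowler_eq_of_frequently (u := fun t => v (Real.exp t))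
    (u₁ := fun t => Real.exp t * deriv v (Real.exp t)) (T := Real.log R)
    hm hmn hp1 hs (fun t ht => hpos _ (hmem t ht))
    (fun t ht => by
      refine ((hv _ (hmem t ht)).comp t (Real.hasDerivAt_exp t)).congr_deriv ?_
      ring)
    (fun t ht => by
      refine ((Real.hasDerivAt_exp t).mul
        ((hv' _ (hmem t ht)).comp t (Real.hasDerivAt_exp t))).congr_deriv ?_
      have h := hode _ (hmem t ht)
      rw [← Real.exp_mul] at h
      have he : Real.exp ((2 + τ) * t) = Real.exp t ^ 2 * Real.exp (t * τ) := by
        rw [pow_two, ← Real.exp_add, ← Real.exp_add]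
        congr 1
        ring
      have h0 := Real.exp_pos t
      rw [he]
      have h2 : deriv (deriv v) (Real.exp t) = -((N' - 1) / Real.exp t * deriv v (Real.exp t))
          - Real.exp (t * τ) * v (Real.exp t) ^ p := by linarith
      simp only [Function.comp_apply]
      rw [h2]
      field_simp
      ring)
    (fun M => by
      have h := hsing M
      rw [← Real.map_exp_atBot, frequently_map] at h
      exact h)
  intro r hr
  have h := key (Real.log r) (Real.log_lt_log hr.1 hr.2)
  simp only [Real.exp_log hr.1] at h
  rw [← h, neg_div, Real.rpow_neg hr.1.le, Real.rpow_def_of_pos hr.1, mul_comm (Real.log r)]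
  field_simp

end
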